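/- Let τ be a positive irrational real number with convergents p_n/q_n such that for every n ≥ 0 the numerator p_n is odd and |q_n τ − p_n| < 2^{−q_n²}. Then for all real constants B > 0 and R > 0 there exists an integer k ≥ 1 such that ∏_{l=1}^{k} |sec(π l τ/2)| > B · R^k. -/

import Mathlib

open Real Finset

/-- The complete quotients of the continued fraction expansion of `x`:
`g 0 = x`, and `g (n+1) = 1 / Int.fract (g n)`. -/
noncomputable def contFracQuot (x : ℝ) : ℕ → ℝ
  | 0 => x
  | n + 1 => (Int.fract (contFracQuot x n))⁻¹

/-- The partial quotients `a n` of the continued fraction expansion of `x`. -/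
noncomputable def contFracA (x : ℝ) (n : ℕ) : ℤ := ⌊contFracQuot x n⌋

/-- The numerators `p n` of the convergents of the continued fraction expansion of `x`,
satisfying the recurrence `pₙ = aₙ pₙ₋₁ + pₙ₋₂` with `p₋₁ = 1`, `p₋₂ = 0`. -/
noncomputable def contFracP (x : ℝ) : ℕ → ℤ
  | 0 => contFracA x 0
  | 1 => contFracA x 1 * contFracA x 0 + 1
  | n + 2 => contFracA x (n + 2) * contFracP x (n + 1) + contFracP x n

/-- The denominators `q n` of the convergents of the continued fraction expansion of `x`,
satisfying the recurrence `qₙ = aₙ qₙ₋₁ + qₙ₋₂` with `q₋₁ = 0`, `q₋₂ = 1`. -/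
noncomputable def contFracQ (x : ℝ) : ℕ → ℤ
  | 0 => 1
  | 1 => contFracA x 1
  | n + 2 => contFracA x (n + 2) * contFracQ x (n + 1) + contFracQ x n

theorem irrational_contFracQuot {x : ℝ} (hx : Irrational x) (n : ℕ) :
    Irrational (contFracQuot x n) := by
  induction n with
  | zero => exact hx
  | succ n ih => exact (ih.sub_intCast ⌊contFracQuot x n⌋).inv

theorem one_le_contFracA_succ {x : ℝ} (hx : Irrational x) (n : ℕ) :
    1 ≤ contFracA x (n + 1) := by
  have h : 0 < Int.fract (contFracQuot x n) :=
    Int.fract_pos.2 ((irrational_contFracQuot hx n).ne_int _)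
  refine Int.le_floor.2 ?_
  rw [Int.cast_one]
  exact (one_le_inv₀ h).2 (Int.fract_lt_one _).le

theorem contFracQ_lower_bound {x : ℝ} (hx : Irrational x) (n : ℕ) :
    1 ≤ contFracQ x n ∧ (n : ℤ) + 1 ≤ contFracQ x (n + 1) := by
  induction n with
  | zero => exact ⟨le_rfl, by simpa [contFracQ] using one_le_contFracA_succ hx 0⟩
  | succ n ih =>
    have ha := one_le_contFracA_succ hx (n + 1)
    obtain ⟨h1, h2⟩ := ih
    refine ⟨by omega, ?_⟩
    rw [contFracQ]
    push_cast
    nlinarith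

theorem abs_cos_odd_mul_pi_div_two_add {p : ℤ} (hp : Odd p) (x : ℝ) :
    |cos (p * π / 2 + x)| = |sin x| := by
  obtain ⟨j, rfl⟩ := hp
  have : ((2 * j + 1 : ℤ) : ℝ) * π / 2 + x = x + π / 2 + j * π := by
    push_cast
    ring
  rw [this, cos_add_int_mul_pi, cos_add_pi_div_two, abs_mul, abs_zpow]
  simp

theorem cos_pi_mul_nat_mul_div_two_ne_zero {x : ℝ} (hx : Irrational x) {l : ℕ} (hl : l ≠ 0) :
    cos (π * l * x / 2) ≠ 0 := by
  rw [Ne, cos_eq_zero_iff]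
  rintro ⟨j, hj⟩
  apply (hx.natCast_mul hl).ne_int (2 * j + 1)
  have : π * (l * x) = π * (2 * j + 1) := by linarith
  push_cast
  exact mul_left_cancel₀ pi_ne_zero this

theorem abs_inv_cos_le_prod {x : ℝ} (hx : Irrational x) {k : ℕ} (hk : 1 ≤ k) :
    |(cos (π * k * x / 2))⁻¹| ≤ ∏ l ∈ Finset.Icc 1 k, |(cos (π * l * x / 2))⁻¹| := by
  obtain ⟨m, rfl⟩ := Nat.exists_eq_add_of_le' hk
  rw [Finset.prod_Icc_succ_top hk]
  refine le_mul_of_one_le_left (abs_nonneg _) (Finset.one_le_prod fun l hl => ?_)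
  have hl : l ≠ 0 := by
    have := (Finset.mem_Icc.1 hl).1
    omega
  rw [abs_inv]
  exact (one_le_inv₀ (abs_pos.2 (cos_pi_mul_nat_mul_div_two_ne_zero hx hl))).2 (abs_cos_le_one _)

theorem abs_cos_le_of_abs_sub_odd {x : ℝ} {k : ℕ} {p : ℤ} (hp : Odd p) :
    |cos (π * k * x / 2)| ≤ 2 * |k * x - p| := by
  have : π * k * x / 2 = p * π / 2 + π / 2 * (k * x - p) := by ring
  rw [this, abs_cos_odd_mul_pi_div_two_add hp]
  refine abs_sin_le_abs.trans ?_
  rw [abs_mul, abs_of_pos (by positivity)]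
  exact mul_le_mul_of_nonneg_right (by linarith [pi_le_four]) (abs_nonneg _)

/-- Let `τ` be a positive irrational number with convergents `p n / q n`
such that every `p n` is odd and `|q n * τ - p n| < 2 ^ (-(q n)²)` for all `n ≥ 0`.
Then for all `B > 0` and `R > 0` there is `k ≥ 1` with
`∏_{l=1}^{k} |sec (π l τ / 2)| > B * R ^ k`. -/
theorem stmt9 (τ : ℝ) (hirr : Irrational τ) (hpos : 0 < τ)
    (hodd : ∀ n : ℕ, Odd (contFracP τ n))
    (happrox : ∀ n : ℕ, |(contFracQ τ n : ℝ) * τ - (contFracP τ n : ℝ)|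
      < (2 : ℝ) ^ (-(((contFracQ τ n).toNat ^ 2 : ℕ) : ℤ))) :
    ∀ B : ℝ, 0 < B → ∀ R : ℝ, 0 < R → ∃ k : ℕ, 1 ≤ k ∧
      B * R ^ k < ∏ l ∈ Finset.Icc 1 k, |(Real.cos (π * l * τ / 2))⁻¹| := by
  intro B hB R hR
  obtain ⟨b, hb⟩ := pow_unbounded_of_one_lt (2 * B) (one_lt_two (α := ℝ))
  obtain ⟨m, hm⟩ := pow_unbounded_of_one_lt R (one_lt_two (α := ℝ))
  have hq := (contFracQ_lower_bound hirr (m + b)).2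
  have happ := happrox (m + b + 1)
  obtain ⟨k, hk⟩ := Int.eq_ofNat_of_zero_le (a := contFracQ τ (m + b + 1)) (by omega)
  rw [hk] at hq happ
  rw [Int.toNat_natCast, Int.cast_natCast, zpow_neg, zpow_natCast] at happ
  have hk1 : 1 ≤ k := by omega
  refine ⟨k, hk1, lt_of_lt_of_le ?_ (abs_inv_cos_le_prod hirr hk1)⟩
  have hcos := abs_cos_le_of_abs_sub_odd (x := τ) (k := k) (hodd (m + b + 1))
  have hcos_pos := abs_pos.2 (cos_pi_mul_nat_mul_div_two_ne_zero hirr (l := k) (by omega))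
  have hexp : b + m * k ≤ k ^ 2 := by
    have : m + b ≤ k := by omega
    nlinarith
  have hgrowth : 2 * (B * R ^ k) < 2 ^ k ^ 2 := calc
    2 * (B * R ^ k) = 2 * B * R ^ k := by ring
    _ < 2 ^ b * (2 ^ m) ^ k := by gcongr
    _ = 2 ^ (b + m * k) := by rw [← pow_mul, ← pow_add]
    _ ≤ 2 ^ k ^ 2 := pow_le_pow_right₀ one_le_two hexp
  rw [abs_inv, lt_inv_comm₀ (by positivity) hcos_pos]
  calc |cos (π * k * τ / 2)| < 2 * (2 ^ k ^ 2)⁻¹ := by linarith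
    _ < 2 * (2 * (B * R ^ k))⁻¹ := by gcongr
    _ = (B * R ^ k)⁻¹ := by field_simp
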